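/- Let R be a K-algebra with an (ℕ^n,⪯)-filtration F such that the associated graded algebra G(R) is an iterated Ore extension over Λ = F_0(R) on homogeneous elements y_1,…,y_s; that is, the standard monomials { y^γ : γ ∈ ℕ^s } form a basis of G(R) as a left Λ-module and each y_i normalizes Λ via a ring endomorphism σ_i. If x_i ∈ F_{α_i}(R) are chosen with y_i = x_i + F_{≺α_i}(R), then the standard monomials { x^γ : γ ∈ ℕ^s } form a basis of R as a left Λ-module; in particular, every r ∈ R can be written r = Σ_{γM ⪯ mdeg_F(r)} a_γ x^γ with a_γ ∈ Λ, and such standard representations have unique coefficients. -/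

import Mathlib

open scoped BigOperators

/-- Multi-indices: elements of `ℕ^n`. -/
abbrev MIdx (n : ℕ) := Fin n → ℕ

/-- An admissible order on `ℕ^n`: a total order compatible with addition and having `0` as
least element. -/
structure AdmOrder (n : ℕ) where
  le : MIdx n → MIdx n → Prop
  le_refl : ∀ a, le a a
  le_trans : ∀ {a b c}, le a b → le b c → le a c
  le_antisymm : ∀ {a b}, le a b → le b a → a = b
  le_total : ∀ a b, le a b ∨ le b a
  add_right : ∀ {a b : MIdx n} (c : MIdx n), le a b → le (a + c) (b + c)
  zero_le : ∀ a, le 0 a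

/-- The strict order associated to an admissible order. -/
def AdmOrder.lt {n : ℕ} (o : AdmOrder n) (a b : MIdx n) : Prop :=
  o.le a b ∧ a ≠ b

/-- The ordered standard monomial `x^γ = x₁^{γ₁} ⋯ x_s^{γ_s}`. -/
def smon {R : Type*} [Monoid R] {s : ℕ} (x : Fin s → R) (γ : MIdx s) : R :=
  (List.ofFn fun i => x i ^ γ i).prod

/-- A `K`-algebra `R` with an `(ℕ^n,⪯)`-filtration `F` whose associated graded algebra
`G(R)` is an iterated Ore extension `Λ[y₁;σ₁]⋯[y_s;σ_s]` over `Λ = F₀(R)` on homogeneous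
elements `y_i` of degree `deg i`, together with chosen lifts `x i ∈ F_{deg i}(R)` of the
`y_i`.  All conditions on `G(R)` are expressed at the filtered level, with
`F_{≺δ}(R) = ⋃_{β ≺ δ} F_β(R)` and `y_i = x_i + F_{≺ deg i}(R)`:
* `span`/`indep` say that the standard monomials `y^γ` (classes of `x^γ` in degree
  `γM = Σ γᵢ·deg i`) form a basis of `G(R)` as a left `Λ`-module;
* `ore_comm` says `y_i·a = σ_i(a)·y_i` for `a ∈ Λ`;
* `q_comm` says `y_j·y_i = q_{ji}·y_i·y_j` for `i < j`. -/
structure OreGradedFiltration (K : Type*) [CommRing K] (R : Type*) [Ring R] [Algebra K R]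
    (n s : ℕ) where
  /-- the admissible order `⪯` on `ℕ^n` -/
  o : AdmOrder n
  /-- the `(ℕ^n,⪯)`-filtration on `R` -/
  F : MIdx n → Submodule K R
  F_mono : ∀ {a b : MIdx n}, o.le a b → F a ≤ F b
  F_mul : ∀ {a b : MIdx n} {u v : R}, u ∈ F a → v ∈ F b → u * v ∈ F (a + b)
  F_exhaustive : ∀ r : R, ∃ a : MIdx n, r ∈ F a
  F_one : (1 : R) ∈ F 0
  /-- `Λ = F₀(R)`, as a subalgebra of `R` -/
  Λ : Subalgebra K R
  hΛ : Subalgebra.toSubmodule Λ = F 0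
  /-- the degrees `α_i` of the homogeneous elements `y_i` -/
  deg : Fin s → MIdx n
  /-- lifts `x_i ∈ F_{α_i}(R)` of the `y_i` -/
  x : Fin s → R
  x_mem : ∀ i, x i ∈ F (deg i)
  /-- the Ore endomorphisms `σ_i` of `Λ` -/
  σ : Fin s → (Λ →+* Λ)
  /-- the commutation scalars `q_{ji} ∈ Λ` -/
  q : Fin s → Fin s → R
  q_mem : ∀ i j : Fin s, q i j ∈ F 0
  /-- `y_i·a = σ_i(a)·y_i` in `G(R)`, for `a ∈ Λ` -/
  ore_comm : ∀ (i : Fin s) (a : Λ),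
    x i * (a : R) - (σ i a : R) * x i ∈ ⨆ β ∈ {β : MIdx n | o.lt β (deg i)}, F β
  /-- `y_j·y_i = q_{ji}·y_i·y_j` in `G(R)`, for `i < j` -/
  q_comm : ∀ i j : Fin s, i < j →
    x j * x i - q j i * (x i * x j) ∈ ⨆ β ∈ {β : MIdx n | o.lt β (deg i + deg j)}, F β
  /-- the monomials `y^γ` span `G(R)` over `Λ` -/
  span : ∀ δ : MIdx n, ∀ r ∈ F δ, ∃ c : MIdx s →₀ R,
    (∀ γ, c γ ∈ F 0) ∧ (∀ γ ∈ c.support, (∑ i, γ i • deg i) = δ) ∧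
    r - (c.sum fun γ a => a * smon x γ) ∈ ⨆ β ∈ {β : MIdx n | o.lt β δ}, F β
  /-- the monomials `y^γ` are left `Λ`-linearly independent in `G(R)` -/
  indep : ∀ (δ : MIdx n) (c : MIdx s →₀ R),
    (∀ γ, c γ ∈ F 0) → (∀ γ ∈ c.support, (∑ i, γ i • deg i) = δ) →
    (c.sum fun γ a => a * smon x γ) ∈ (⨆ β ∈ {β : MIdx n | o.lt β δ}, F β) → c = 0

namespace OreGradedFiltration

variable {K : Type*} [CommRing K] {R : Type*} [Ring R] [Algebra K R] {n s : ℕ}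

/-- `F_{≺δ}(R) = ⋃_{β ≺ δ} F_β(R)`. -/
def Flt (E : OreGradedFiltration K R n s) (δ : MIdx n) : Submodule K R :=
  ⨆ β ∈ {β : MIdx n | E.o.lt β δ}, E.F β

/-- `γM = γ₁α₁ + ⋯ + γ_sα_s ∈ ℕ^n`. -/
def degM (E : OreGradedFiltration K R n s) (γ : MIdx s) : MIdx n :=
  ∑ i, γ i • E.deg i

end OreGradedFiltration

theorem AdmOrder.le_of_le {n : ℕ} (o : AdmOrder n) {a b : MIdx n} (h : a ≤ b) : o.le a b := by
  have := o.add_right a (o.zero_le (b - a))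
  rwa [zero_add, tsub_add_cancel_of_le h] at this

/-- Admissible orders are well-founded, by Dickson's lemma. -/
theorem AdmOrder.wellFounded_lt {n : ℕ} (o : AdmOrder n) : WellFounded o.lt := by
  rw [wellFounded_iff_isEmpty_descending_chain]
  refine ⟨fun ⟨f, hf⟩ => ?_⟩
  have anti : ∀ i k : ℕ, o.lt (f (i + k + 1)) (f i) := by
    intro i k
    induction k with
    | zero => exact hf i
    | succ k ih =>
      refine ⟨o.le_trans (hf (i + k + 1)).1 ih.1, fun h => ?_⟩
      exact ih.2 (o.le_antisymm ih.1 (h ▸ (hf (i + k + 1)).1))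
  obtain ⟨i, j, hij, hle⟩ := wellQuasiOrdered_le f
  obtain ⟨k, rfl⟩ := Nat.exists_eq_add_of_lt hij
  exact (anti i k).2 (o.le_antisymm (anti i k).1 (o.le_of_le hle))

theorem AdmOrder.exists_max_image {n : ℕ} (o : AdmOrder n) {ι : Type*} (f : ι → MIdx n)
    {t : Finset ι} (ht : t.Nonempty) : ∃ i ∈ t, ∀ j ∈ t, o.le (f j) (f i) := by
  induction ht using Finset.Nonempty.cons_induction with
  | singleton a => exact ⟨a, by simp, by simpa using o.le_refl _⟩
  | cons a t ha ht ih =>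
    obtain ⟨i, hi, hmax⟩ := ih
    simp only [Finset.mem_cons, forall_eq_or_imp, exists_eq_or_imp]
    rcases o.le_total (f a) (f i) with h | h
    · exact Or.inr ⟨i, hi, h, hmax⟩
    · exact Or.inl ⟨o.le_refl _, fun j hj => o.le_trans (hmax j hj) h⟩

namespace OreGradedFiltration

variable {K : Type*} [CommRing K] {R : Type*} [Ring R] [Algebra K R] {n s : ℕ}

theorem pow_mem_F (E : OreGradedFiltration K R n s) {a : MIdx n} {u : R} (hu : u ∈ E.F a)
    (k : ℕ) : u ^ k ∈ E.F (k • a) := by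
  induction k with
  | zero => simpa using E.F_one
  | succ k ih => rw [pow_succ, succ_nsmul]; exact E.F_mul ih hu

theorem prod_ofFn_mem_F (E : OreGradedFiltration K R n s) {m : ℕ} {f : Fin m → R}
    {g : Fin m → MIdx n} (h : ∀ i, f i ∈ E.F (g i)) :
    (List.ofFn f).prod ∈ E.F (∑ i, g i) := by
  induction m with
  | zero => simpa using E.F_one
  | succ m ih =>
    rw [List.ofFn_succ, List.prod_cons, Fin.sum_univ_succ]
    exact E.F_mul (h 0) (ih fun i => h i.succ)

theorem smon_mem_F (E : OreGradedFiltration K R n s) (γ : MIdx s) :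
    smon E.x γ ∈ E.F (E.degM γ) :=
  E.prod_ofFn_mem_F fun i => E.pow_mem_F (E.x_mem i) (γ i)

theorem mul_smon_mem_F (E : OreGradedFiltration K R n s) {a : R} (ha : a ∈ E.F 0)
    (γ : MIdx s) : a * smon E.x γ ∈ E.F (E.degM γ) := by
  simpa using E.F_mul ha (E.smon_mem_F γ)

theorem F_le_Flt (E : OreGradedFiltration K R n s) {β δ : MIdx n} (h : E.o.lt β δ) :
    E.F β ≤ E.Flt δ :=
  le_iSup₂_of_le (f := fun β (_ : β ∈ {β : MIdx n | E.o.lt β δ}) => E.F β) β h le_rfl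

/-- The elements having a standard representation by monomials of degree at most `d`. -/
def standardSpan (E : OreGradedFiltration K R n s) (d : MIdx n) : Submodule K R where
  carrier := {r | ∃ c : MIdx s →₀ R, (∀ γ, c γ ∈ E.F 0) ∧
    (∀ γ ∈ c.support, E.o.le (E.degM γ) d) ∧ r = c.sum fun γ a => a * smon E.x γ}
  zero_mem' := ⟨0, by simp, by simp, by simp⟩
  add_mem' := by
    classical
    rintro _ _ ⟨c, hc, hd, rfl⟩ ⟨c', hc', hd', rfl⟩
    refine ⟨c + c', fun γ => add_mem (hc γ) (hc' γ), fun γ hγ => ?_, ?_⟩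
    · exact (Finset.mem_union.1 (Finsupp.support_add hγ)).elim (hd γ) (hd' γ)
    · rw [Finsupp.sum_add_index'] <;> simp [add_mul]
  smul_mem' := by
    rintro k _ ⟨c, hc, hd, rfl⟩
    refine ⟨k • c, fun γ => Submodule.smul_mem _ k (hc γ),
      fun γ hγ => hd γ (Finsupp.support_smul hγ), ?_⟩
    rw [Finsupp.sum_smul_index' (by simp), Finsupp.smul_sum]
    simp

theorem standardSpan_mono (E : OreGradedFiltration K R n s) {d e : MIdx n}
    (h : E.o.le d e) : E.standardSpan d ≤ E.standardSpan e :=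
  fun _ ⟨c, hc, hd, hr⟩ => ⟨c, hc, fun γ hγ => E.o.le_trans (hd γ hγ) h, hr⟩

theorem F_le_standardSpan (E : OreGradedFiltration K R n s) (d : MIdx n) :
    E.F d ≤ E.standardSpan d := by
  induction d using E.o.wellFounded_lt.induction with
  | _ d ih =>
    intro r hr
    obtain ⟨c, hc, hd, hrest⟩ := E.span d r hr
    have hFlt : E.Flt d ≤ E.standardSpan d :=
      iSup₂_le fun β hβ => (ih β hβ).trans (E.standardSpan_mono hβ.1)
    rw [← sub_add_cancel r (c.sum fun γ a => a * smon E.x γ)]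
    refine add_mem (hFlt hrest) ⟨c, hc, fun γ hγ => ?_, rfl⟩
    rw [degM, hd γ hγ]
    exact E.o.le_refl d

theorem eq_zero_of_sum_mul_smon_eq_zero (E : OreGradedFiltration K R n s) {c : MIdx s →₀ R}
    (hc : ∀ γ, c γ ∈ E.F 0) (h : (c.sum fun γ a => a * smon E.x γ) = 0) : c = 0 := by
  classical
  by_contra hne
  obtain ⟨γ₀, hγ₀, hmax⟩ := E.o.exists_max_image E.degM (Finsupp.support_nonempty_iff.2 hne)
  set p : MIdx s → Prop := fun γ => E.degM γ = E.degM γ₀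
  have hlow : ((c.filter fun γ => ¬ p γ).sum fun γ a => a * smon E.x γ)
      ∈ E.Flt (E.degM γ₀) := by
    refine Submodule.sum_mem _ fun γ hγ => ?_
    rw [Finsupp.support_filter, Finset.mem_filter] at hγ
    rw [Finsupp.filter_apply_pos (fun γ => ¬ p γ) c hγ.2]
    exact E.F_le_Flt ⟨hmax γ hγ.1, hγ.2⟩ (E.mul_smon_mem_F (hc γ) γ)
  have htop : ((c.filter p).sum fun γ a => a * smon E.x γ) ∈ E.Flt (E.degM γ₀) := by
    rw [← Finsupp.filter_add_filter_not c p, Finsupp.sum_add_index' (by simp)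
      (by simp [add_mul])] at h
    rw [eq_neg_of_add_eq_zero_left h]
    exact neg_mem hlow
  have hzero : c.filter p = 0 := by
    refine E.indep (E.degM γ₀) _ (fun γ => ?_) (fun γ hγ => ?_) htop
    · rw [Finsupp.filter_apply]
      split_ifs
      exacts [hc γ, zero_mem _]
    · rw [Finsupp.support_filter, Finset.mem_filter] at hγ
      exact hγ.2
  refine Finsupp.mem_support_iff.1 hγ₀ ?_
  rw [← Finsupp.filter_apply_pos p c rfl, hzero, Finsupp.zero_apply]

end OreGradedFiltration

/-- If `G(R)` is an iterated Ore extension over `Λ = F₀(R)` on homogeneous elements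
`y_1,…,y_s` with lifts `x_i ∈ F_{α_i}(R)`, then the standard monomials
`{x^γ : γ ∈ ℕ^s}` form a basis of `R` as a left `Λ`-module; in particular every `r ∈ R`
with multidegree `d = mdeg_F(r)` can be written `r = Σ_{γM ⪯ d} a_γ x^γ` with `a_γ ∈ Λ`,
and such standard representations have unique coefficients. -/
theorem oreGraded_standard_monomial_basis {K : Type*} [CommRing K] {R : Type*} [Ring R]
    [Algebra K R] {n s : ℕ} (E : OreGradedFiltration K R n s) :
    (∀ r : R, ∃ c : MIdx s →₀ R, (∀ γ, c γ ∈ E.F 0) ∧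
      r = c.sum fun γ a => a * smon E.x γ) ∧
    (∀ (r : R) (d : MIdx n), r ∈ E.F d → (∀ d', r ∈ E.F d' → E.o.le d d') →
      ∃ c : MIdx s →₀ R, (∀ γ, c γ ∈ E.F 0) ∧
        (∀ γ ∈ c.support, E.o.le (E.degM γ) d) ∧
        r = c.sum fun γ a => a * smon E.x γ) ∧
    (∀ c : MIdx s →₀ R, (∀ γ, c γ ∈ E.F 0) →
      (c.sum fun γ a => a * smon E.x γ) = 0 → c = 0) := by
  refine ⟨fun r => ?_, fun r d hr _ => E.F_le_standardSpan d hr,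
    fun c hc h => E.eq_zero_of_sum_mul_smon_eq_zero hc h⟩
  obtain ⟨d, hd⟩ := E.F_exhaustive r
  obtain ⟨c, hc, -, hr⟩ := E.F_le_standardSpan d hd
  exact ⟨c, hc, hr⟩
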